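/- Let α>1 and 0<β<∞, let u be holomorphic on 𝔻 and φ a holomorphic self-map of 𝔻, and suppose uC_φ maps B^α boundedly into H^∞_{ν_β}. Then there exist constants c, C > 0 depending only on α and β (not on u and φ) such that c · limsup_{n→∞} (n+1)^{α-1} ‖u·φ^n‖_{ν_β} ≤ ‖uC_φ‖_e ≤ C · limsup_{n→∞} (n+1)^{α-1} ‖u·φ^n‖_{ν_β}, where ‖uC_φ‖_e is the essential norm of uC_φ : B^α → H^∞_{ν_β}. -/

import Mathlib

open Complex Filter Set

noncomputable section

/-- The open unit disk in `ℂ`. -/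
def unitDisk : Set ℂ := Metric.ball 0 1

/-- The weighted sup-norm `‖g‖_{ν_γ} = sup_{z ∈ 𝔻} (1-|z|²)^γ |g(z)|`. -/
def wnorm (γ : ℝ) (g : ℂ → ℂ) : ℝ :=
  sSup ((fun z => (1 - ‖z‖ ^ 2) ^ γ * ‖g z‖) '' unitDisk)

/-- Membership in the weighted Banach space `H^∞_{ν_β}`. -/
def MemWeighted (β : ℝ) (g : ℂ → ℂ) : Prop :=
  DifferentiableOn ℂ g unitDisk ∧
    BddAbove ((fun z => (1 - ‖z‖ ^ 2) ^ β * ‖g z‖) '' unitDisk)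

/-- Membership in the Bloch type space `B^α`. -/
def MemBloch (α : ℝ) (f : ℂ → ℂ) : Prop :=
  DifferentiableOn ℂ f unitDisk ∧
    BddAbove ((fun z => (1 - ‖z‖ ^ 2) ^ α * ‖deriv f z‖) '' unitDisk)

/-- The Bloch type norm `‖f‖_{B^α} = |f(0)| + sup_{z∈𝔻}(1-|z|²)^α |f'(z)|`. -/
def blochNorm (α : ℝ) (f : ℂ → ℂ) : ℝ :=
  ‖f 0‖ + wnorm α (deriv f)

/-- Membership in the Zygmund type space `Z_β`. -/
def MemZygmund (β : ℝ) (f : ℂ → ℂ) : Prop :=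
  DifferentiableOn ℂ f unitDisk ∧
    BddAbove ((fun z => (1 - ‖z‖ ^ 2) ^ β * ‖deriv (deriv f) z‖) '' unitDisk)

/-- The Zygmund type norm `‖f‖_{Z_β} = |f(0)| + |f'(0)| + sup_{z∈𝔻}(1-|z|²)^β |f''(z)|`. -/
def zygNorm (β : ℝ) (f : ℂ → ℂ) : ℝ :=
  ‖f 0‖ + ‖deriv f 0‖ + wnorm β (deriv (deriv f))

/-- The weighted composition operator `uC_φ f = u · (f ∘ φ)`. -/
def wcomp (u φ f : ℂ → ℂ) : ℂ → ℂ := fun z => u z * f (φ z)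

/-- `uC_φ` maps `B^α` boundedly into `Z_β`. -/
def BoundedBlochToZygmund (α β : ℝ) (u φ : ℂ → ℂ) : Prop :=
  (∀ f, MemBloch α f → MemZygmund β (wcomp u φ f)) ∧
    ∃ C > 0, ∀ f, MemBloch α f → zygNorm β (wcomp u φ f) ≤ C * blochNorm α f

/-- `uC_φ` maps `B^α` boundedly into `H^∞_{ν_β}`. -/
def BoundedBlochToWeighted (α β : ℝ) (u φ : ℂ → ℂ) : Prop :=
  (∀ f, MemBloch α f → MemWeighted β (wcomp u φ f)) ∧
    ∃ C > 0, ∀ f, MemBloch α f → wnorm β (wcomp u φ f) ≤ C * blochNorm α f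

/-- `uC_φ : B^α → Z_β` is compact: it is bounded and maps bounded sets of `B^α` to
totally bounded (equivalently, since `Z_β` is complete, relatively compact) subsets
of `Z_β`. -/
def CompactBlochToZygmund (α β : ℝ) (u φ : ℂ → ℂ) : Prop :=
  BoundedBlochToZygmund α β u φ ∧
    ∀ r : ℝ, ∀ ε : ℝ, 0 < ε → ∃ T : Finset (ℂ → ℂ),
      (∀ g ∈ T, MemZygmund β g) ∧
      ∀ f, MemBloch α f → blochNorm α f ≤ r →
        ∃ g ∈ T, zygNorm β (fun z => wcomp u φ f z - g z) ≤ ε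

/-- `uC_φ : B^α → H^∞_{ν_β}` is compact: it is bounded and maps bounded sets of `B^α`
to totally bounded (equivalently, relatively compact) subsets of `H^∞_{ν_β}`. -/
def CompactBlochToWeighted (α β : ℝ) (u φ : ℂ → ℂ) : Prop :=
  BoundedBlochToWeighted α β u φ ∧
    ∀ r : ℝ, ∀ ε : ℝ, 0 < ε → ∃ T : Finset (ℂ → ℂ),
      (∀ g ∈ T, MemWeighted β g) ∧
      ∀ f, MemBloch α f → blochNorm α f ≤ r →
        ∃ g ∈ T, wnorm β (fun z => wcomp u φ f z - g z) ≤ ε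

/-- A compact (linear, bounded, with totally bounded image of the unit ball) operator
from the subspace of `B^α` cut out by the predicate `P` into `Z_β`. -/
def IsCompactOpToZygmund (α β : ℝ) (P : (ℂ → ℂ) → Prop) (K : (ℂ → ℂ) → ℂ → ℂ) : Prop :=
  (∀ f g, P f → P g → ∀ a b : ℂ,
      K (fun z => a * f z + b * g z) = fun z => a * K f z + b * K g z) ∧
  (∀ f, P f → MemZygmund β (K f)) ∧
  (∃ C, ∀ f, P f → zygNorm β (K f) ≤ C * blochNorm α f) ∧
  (∀ ε : ℝ, 0 < ε → ∃ T : Finset (ℂ → ℂ), (∀ g ∈ T, MemZygmund β g) ∧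
      ∀ f, P f → blochNorm α f ≤ 1 → ∃ g ∈ T, zygNorm β (fun z => K f z - g z) ≤ ε)

/-- The essential norm of `uC_φ`, as an operator from the subspace of `B^α` cut out by
the predicate `P` into `Z_β`: the distance to the compact operators, the operator norm
being the supremum over the unit ball. -/
def essNormZ (α β : ℝ) (P : (ℂ → ℂ) → Prop) (u φ : ℂ → ℂ) : ℝ :=
  sInf {r | ∃ K, IsCompactOpToZygmund α β P K ∧
    r = sSup {s | ∃ f, P f ∧ blochNorm α f ≤ 1 ∧
          s = zygNorm β (fun z => wcomp u φ f z - K f z)}}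

/-- A compact (linear, bounded, with totally bounded image of the unit ball) operator
from `B^α` into `H^∞_{ν_β}`. -/
def IsCompactOpToWeighted (α β : ℝ) (K : (ℂ → ℂ) → ℂ → ℂ) : Prop :=
  (∀ f g, MemBloch α f → MemBloch α g → ∀ a b : ℂ,
      K (fun z => a * f z + b * g z) = fun z => a * K f z + b * K g z) ∧
  (∀ f, MemBloch α f → MemWeighted β (K f)) ∧
  (∃ C, ∀ f, MemBloch α f → wnorm β (K f) ≤ C * blochNorm α f) ∧
  (∀ ε : ℝ, 0 < ε → ∃ T : Finset (ℂ → ℂ), (∀ g ∈ T, MemWeighted β g) ∧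
      ∀ f, MemBloch α f → blochNorm α f ≤ 1 → ∃ g ∈ T, wnorm β (fun z => K f z - g z) ≤ ε)

/-- The essential norm of `uC_φ : B^α → H^∞_{ν_β}`. -/
def essNormW (α β : ℝ) (u φ : ℂ → ℂ) : ℝ :=
  sInf {r | ∃ K, IsCompactOpToWeighted α β K ∧
    r = sSup {s | ∃ f, MemBloch α f ∧ blochNorm α f ≤ 1 ∧
          s = wnorm β (fun z => wcomp u φ f z - K f z)}}

/-- `limsup_{|φ(z)|→1} F(z) = lim_{s→1⁻} sup {F z : z ∈ 𝔻, |φ z| > s}`.  Since the inner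
supremum is nonincreasing in `s`, the limit equals the infimum over `s ∈ [0,1)`; note
that `Real.sSup ∅ = 0`, matching the convention that the value is `0` when
`{z : |φ z| > s}` is empty for some `s < 1`. -/
def phiLimsup (φ : ℂ → ℂ) (F : ℂ → ℝ) : ℝ :=
  sInf ((fun s => sSup {y | ∃ z ∈ unitDisk, s < ‖φ z‖ ∧ y = F z}) '' Set.Ico (0:ℝ) 1)

section WeightedNorm

theorem mem_unitDisk_iff {z : ℂ} : z ∈ unitDisk ↔ ‖z‖ < 1 := by
  simp [unitDisk]

theorem isOpen_unitDisk : IsOpen unitDisk := Metric.isOpen_ball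

theorem one_sub_sq_pos {z : ℂ} (hz : z ∈ unitDisk) : 0 < 1 - ‖z‖ ^ 2 := by
  have h := mem_unitDisk_iff.1 hz
  nlinarith [norm_nonneg z]

theorem weight_nonneg (γ : ℝ) {z : ℂ} (hz : z ∈ unitDisk) : 0 ≤ (1 - ‖z‖ ^ 2) ^ γ :=
  Real.rpow_nonneg (one_sub_sq_pos hz).le _

/-- Finiteness of the weighted sup-norm. -/
def WeightedBdd (γ : ℝ) (g : ℂ → ℂ) : Prop :=
  BddAbove ((fun z => (1 - ‖z‖ ^ 2) ^ γ * ‖g z‖) '' unitDisk)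

variable {γ c : ℝ} {f g : ℂ → ℂ}

theorem wnorm_le (h : ∀ z ∈ unitDisk, (1 - ‖z‖ ^ 2) ^ γ * ‖g z‖ ≤ c) : wnorm γ g ≤ c := by
  refine csSup_le ⟨_, 0, by simp [unitDisk], rfl⟩ ?_
  rintro _ ⟨z, hz, rfl⟩
  exact h z hz

theorem WeightedBdd.of_le (h : ∀ z ∈ unitDisk, (1 - ‖z‖ ^ 2) ^ γ * ‖g z‖ ≤ c) :
    WeightedBdd γ g := by
  refine ⟨c, ?_⟩
  rintro _ ⟨z, hz, rfl⟩
  exact h z hz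

theorem WeightedBdd.le_wnorm (h : WeightedBdd γ g) {z : ℂ} (hz : z ∈ unitDisk) :
    (1 - ‖z‖ ^ 2) ^ γ * ‖g z‖ ≤ wnorm γ g :=
  le_csSup h ⟨z, hz, rfl⟩

theorem wnorm_nonneg (γ : ℝ) (g : ℂ → ℂ) : 0 ≤ wnorm γ g := by
  refine Real.sSup_nonneg ?_
  rintro _ ⟨z, hz, rfl⟩
  exact mul_nonneg (weight_nonneg γ hz) (norm_nonneg _)

theorem blochNorm_nonneg (α : ℝ) (f : ℂ → ℂ) : 0 ≤ blochNorm α f :=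
  add_nonneg (norm_nonneg _) (wnorm_nonneg _ _)

theorem weight_mul_norm_add_le (hf : WeightedBdd γ f) (hg : WeightedBdd γ g) {z : ℂ}
    (hz : z ∈ unitDisk) :
    (1 - ‖z‖ ^ 2) ^ γ * ‖f z + g z‖ ≤ wnorm γ f + wnorm γ g :=
  calc (1 - ‖z‖ ^ 2) ^ γ * ‖f z + g z‖
      ≤ (1 - ‖z‖ ^ 2) ^ γ * (‖f z‖ + ‖g z‖) :=
        mul_le_mul_of_nonneg_left (norm_add_le _ _) (weight_nonneg γ hz)
    _ ≤ _ := by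
        rw [mul_add]
        exact add_le_add (hf.le_wnorm hz) (hg.le_wnorm hz)

theorem WeightedBdd.add (hf : WeightedBdd γ f) (hg : WeightedBdd γ g) :
    WeightedBdd γ (fun z => f z + g z) :=
  .of_le fun _ hz => weight_mul_norm_add_le hf hg hz

theorem wnorm_add_le (hf : WeightedBdd γ f) (hg : WeightedBdd γ g) :
    wnorm γ (fun z => f z + g z) ≤ wnorm γ f + wnorm γ g :=
  wnorm_le fun _ hz => weight_mul_norm_add_le hf hg hz

theorem wnorm_neg (γ : ℝ) (g : ℂ → ℂ) : wnorm γ (fun z => -g z) = wnorm γ g := by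
  simp [wnorm]

theorem WeightedBdd.neg (hg : WeightedBdd γ g) : WeightedBdd γ (fun z => -g z) := by
  simpa [WeightedBdd] using hg

theorem WeightedBdd.sub (hf : WeightedBdd γ f) (hg : WeightedBdd γ g) :
    WeightedBdd γ (fun z => f z - g z) := by
  simpa only [sub_eq_add_neg] using hf.add hg.neg

theorem wnorm_sub_le (hf : WeightedBdd γ f) (hg : WeightedBdd γ g) :
    wnorm γ (fun z => f z - g z) ≤ wnorm γ f + wnorm γ g := by
  simpa only [sub_eq_add_neg, wnorm_neg] using wnorm_add_le hf hg.neg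

theorem wnorm_le_wnorm_sub_add (hf : WeightedBdd γ f) (hg : WeightedBdd γ g) :
    wnorm γ f ≤ wnorm γ (fun z => f z - g z) + wnorm γ g := by
  simpa only [sub_add_cancel] using wnorm_add_le (hf.sub hg) hg

theorem wnorm_const_mul (γ : ℝ) (a : ℂ) (g : ℂ → ℂ) :
    wnorm γ (fun z => a * g z) = ‖a‖ * wnorm γ g := by
  rw [wnorm, wnorm, ← smul_eq_mul, ← Real.sSup_smul_of_nonneg (norm_nonneg a)]
  congr 1
  ext x
  simp [Set.mem_smul_set, mul_left_comm]

theorem WeightedBdd.const_mul (hg : WeightedBdd γ g) (a : ℂ) :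
    WeightedBdd γ (fun z => a * g z) := by
  refine .of_le (c := ‖a‖ * wnorm γ g) fun z hz => ?_
  rw [norm_mul, mul_left_comm]
  exact mul_le_mul_of_nonneg_left (hg.le_wnorm hz) (norm_nonneg a)

theorem WeightedBdd.sum {ι : Type*} {F : Finset ι} {h : ι → ℂ → ℂ}
    (hh : ∀ i ∈ F, WeightedBdd γ (h i)) : WeightedBdd γ (fun z => ∑ i ∈ F, h i z) := by
  classical
  induction F using Finset.induction_on with
  | empty => exact .of_le (c := 0) fun z _ => by simp
  | insert i s hi ih =>
    simp only [Finset.sum_insert hi]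
    exact (hh i (by simp)).add (ih fun j hj => hh j (by simp [hj]))

theorem wnorm_sum_le {ι : Type*} {F : Finset ι} {h : ι → ℂ → ℂ}
    (hh : ∀ i ∈ F, WeightedBdd γ (h i)) :
    wnorm γ (fun z => ∑ i ∈ F, h i z) ≤ ∑ i ∈ F, wnorm γ (h i) := by
  refine wnorm_le fun z hz => ?_
  calc (1 - ‖z‖ ^ 2) ^ γ * ‖∑ i ∈ F, h i z‖
      ≤ (1 - ‖z‖ ^ 2) ^ γ * ∑ i ∈ F, ‖h i z‖ :=
        mul_le_mul_of_nonneg_left (norm_sum_le _ _) (weight_nonneg γ hz)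
    _ ≤ _ := by
        rw [Finset.mul_sum]
        exact Finset.sum_le_sum fun i hi => (hh i hi).le_wnorm hz

end WeightedNorm

section Bloch

variable {α : ℝ} {f : ℂ → ℂ}

theorem MemBloch.differentiableAt (hf : MemBloch α f) {z : ℂ} (hz : ‖z‖ < 1) :
    DifferentiableAt ℂ f z :=
  hf.1.differentiableAt (isOpen_unitDisk.mem_nhds (mem_unitDisk_iff.2 hz))

theorem MemBloch.norm_deriv_le (hα : 0 ≤ α) (hf : MemBloch α f) {z : ℂ} {s : ℝ}
    (hz : ‖z‖ ≤ s) (hs : s < 1) :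
    ‖deriv f z‖ ≤ wnorm α (deriv f) * (1 - s) ^ (-α) := by
  have hz' : z ∈ unitDisk := mem_unitDisk_iff.2 (hz.trans_lt hs)
  have hpos : 0 < (1 - s) ^ α := Real.rpow_pos_of_pos (by linarith) _
  rw [Real.rpow_neg (by linarith), ← div_eq_mul_inv, le_div_iff₀ hpos, mul_comm]
  refine le_trans ?_ (WeightedBdd.le_wnorm hf.2 hz')
  have : 1 - s ≤ 1 - ‖z‖ ^ 2 := by nlinarith [norm_nonneg z]
  gcongr

/-- Radial growth of Bloch type functions for `α > 1`. -/
theorem MemBloch.norm_sub_radial_le (hα : 1 < α) (hf : MemBloch α f) {w : ℂ} (hw : ‖w‖ < 1)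
    {r : ℝ} (hr0 : 0 ≤ r) (hr1 : r ≤ 1) :
    ‖f w - f (r * w)‖ ≤ wnorm α (deriv f) * ((1 - ‖w‖) ^ (1 - α) / (α - 1)) := by
  set S := wnorm α (deriv f)
  have hS : 0 ≤ S := wnorm_nonneg _ _
  have hα' : 0 < α - 1 := by linarith
  have hlt : ∀ t ∈ Icc r 1, t * ‖w‖ < 1 := fun t ht => by
    nlinarith [norm_nonneg w, ht.2]
  have hnorm : ∀ t ∈ Icc r 1, ‖(t : ℂ) * w‖ = t * ‖w‖ := fun t ht => by
    rw [norm_mul, Complex.norm_real, Real.norm_of_nonneg (hr0.trans ht.1)]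
  have hder : ∀ t ∈ Icc r 1, HasDerivAt (fun t : ℝ => f (t * w) - f (r * w))
      (deriv f (t * w) * w) t := fun t ht => by
    have h1 : HasDerivAt (fun z : ℂ => z * w) w (t : ℂ) := by
      simpa using (hasDerivAt_id (t : ℂ)).mul_const w
    have h2 := (hf.differentiableAt (z := t * w) ((hnorm t ht).trans_lt (hlt t ht))).hasDerivAt
    exact ((h2.comp (t : ℂ) h1).comp_ofReal).sub_const _
  have hB : ∀ t ∈ Icc r 1, HasDerivAt (fun t : ℝ => S * ((1 - t * ‖w‖) ^ (1 - α) / (α - 1)))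
      (S * (‖w‖ * (1 - t * ‖w‖) ^ (-α))) t := fun t ht => by
    have h1 : HasDerivAt (fun t : ℝ => 1 - t * ‖w‖) (-‖w‖) t := by
      simpa using ((hasDerivAt_id t).mul_const ‖w‖).const_sub 1
    have h2 := ((h1.rpow_const (p := 1 - α) (Or.inl (by linarith [hlt t ht]))).div_const
      (α - 1)).const_mul S
    refine h2.congr_deriv ?_
    rw [show 1 - α - 1 = -α by ring]
    field_simp
    ring
  have key := image_norm_le_of_norm_deriv_right_le_deriv_boundary'
    (f := fun t : ℝ => f (t * w) - f (r * w)) (a := r) (b := 1)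
    (fun t ht => (hder t ht).continuousAt.continuousWithinAt)
    (fun t ht => (hder t (Ico_subset_Icc_self ht)).hasDerivWithinAt)
    (B := fun t : ℝ => S * ((1 - t * ‖w‖) ^ (1 - α) / (α - 1)))
    (by
      have := hlt r ⟨le_rfl, hr1⟩
      simp only [sub_self, norm_zero]
      exact mul_nonneg hS (div_nonneg (Real.rpow_nonneg (by linarith) _) hα'.le))
    (fun t ht => (hB t ht).continuousAt.continuousWithinAt)
    (fun t ht => (hB t (Ico_subset_Icc_self ht)).hasDerivWithinAt)
    (fun t ht => by
      have ht' := Ico_subset_Icc_self ht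
      rw [norm_mul, mul_comm ‖w‖, ← mul_assoc]
      exact mul_le_mul_of_nonneg_right
        (hf.norm_deriv_le (by linarith) (hnorm t ht').le (hlt t ht')) (norm_nonneg w))
    (right_mem_Icc.2 hr1)
  simpa using key

theorem MemBloch.norm_le (hα : 1 < α) (hf : MemBloch α f) {w : ℂ} {ρ : ℝ} (hw : ‖w‖ ≤ ρ)
    (hρ : ρ < 1) :
    ‖f w‖ ≤ (1 + (1 - ρ) ^ (1 - α) / (α - 1)) * blochNorm α f := by
  have h := hf.norm_sub_radial_le hα (hw.trans_lt hρ) le_rfl zero_le_one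
  simp only [Complex.ofReal_zero, zero_mul] at h
  have h1 : (1 - ‖w‖) ^ (1 - α) ≤ (1 - ρ) ^ (1 - α) :=
    Real.rpow_le_rpow_of_nonpos (by linarith) (by linarith) (by linarith)
  have h2 : ‖f w‖ ≤ ‖f w - f 0‖ + ‖f 0‖ := by simpa using norm_add_le (f w - f 0) (f 0)
  have hα' : 0 < α - 1 := by linarith
  have hD : (1 - ‖w‖) ^ (1 - α) / (α - 1) ≤ (1 - ρ) ^ (1 - α) / (α - 1) := by gcongr
  have hD0 : 0 ≤ (1 - ρ) ^ (1 - α) / (α - 1) :=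
    div_nonneg (Real.rpow_nonneg (by linarith) _) hα'.le
  have hS := wnorm_nonneg α (deriv f)
  rw [blochNorm]
  nlinarith [mul_le_mul_of_nonneg_left hD hS, norm_nonneg (f 0),
    mul_nonneg hD0 (norm_nonneg (f 0))]

theorem MemBloch.norm_sub_le_of_norm_le (hα : 0 ≤ α) (hf : MemBloch α f) {w : ℂ} {s r : ℝ}
    (hw : ‖w‖ ≤ s) (hs : s < 1) (hr0 : 0 ≤ r) (hr1 : r ≤ 1) :
    ‖f w - f (r * w)‖ ≤ wnorm α (deriv f) * (1 - s) ^ (-α) * (1 - r) := by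
  have hrw : ‖(r : ℂ) * w‖ ≤ s := by
    rw [norm_mul, Complex.norm_real, Real.norm_of_nonneg hr0]
    nlinarith [norm_nonneg w]
  have h := Convex.norm_image_sub_le_of_norm_deriv_le (f := f) (s := Metric.closedBall 0 s)
    (C := wnorm α (deriv f) * (1 - s) ^ (-α))
    (fun z hz => hf.differentiableAt ((mem_closedBall_zero_iff.1 hz).trans_lt hs))
    (fun z hz => hf.norm_deriv_le hα (mem_closedBall_zero_iff.1 hz) hs)
    (convex_closedBall 0 s) (mem_closedBall_zero_iff.2 hrw) (mem_closedBall_zero_iff.2 hw)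
  refine h.trans (mul_le_mul_of_nonneg_left ?_
    (mul_nonneg (wnorm_nonneg _ _) (Real.rpow_nonneg (by linarith) _)))
  have : w - r * w = ((1 - r : ℝ) : ℂ) * w := by push_cast; ring
  rw [this, norm_mul, Complex.norm_real, Real.norm_of_nonneg (by linarith)]
  nlinarith [norm_nonneg w]

end Bloch

section CauchyCoeff

/-- The `n`-th Taylor coefficient at `0`, computed on the circle of radius `ρ`. -/
def cauchyCoeff (ρ : ℝ) (n : ℕ) (f : ℂ → ℂ) : ℂ :=
  (2 * (Real.pi : ℂ) * Complex.I)⁻¹ * ∮ z in C(0, ρ), (z⁻¹) ^ (n + 1) * f z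

variable {ρ : ℝ} {f g : ℂ → ℂ}

theorem circleIntegrable_inv_pow_mul (hρ : 0 < ρ) (n : ℕ)
    (hf : ContinuousOn f (Metric.sphere 0 ρ)) :
    CircleIntegrable (fun z => (z⁻¹) ^ (n + 1) * f z) 0 ρ := by
  refine ContinuousOn.circleIntegrable hρ.le (ContinuousOn.mul (ContinuousOn.pow ?_ _) hf)
  refine continuousOn_id.inv₀ fun z hz => ?_
  rintro rfl
  simp at hz
  exact hρ.ne hz

theorem cauchyCoeff_lincomb (hρ : 0 < ρ) (n : ℕ) (hf : ContinuousOn f (Metric.sphere 0 ρ))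
    (hg : ContinuousOn g (Metric.sphere 0 ρ)) (a b : ℂ) :
    cauchyCoeff ρ n (fun z => a * f z + b * g z) =
      a * cauchyCoeff ρ n f + b * cauchyCoeff ρ n g := by
  have h1 := circleIntegrable_inv_pow_mul hρ n (hf.const_mul a)
  have h2 := circleIntegrable_inv_pow_mul hρ n (hg.const_mul b)
  simp only [cauchyCoeff, mul_add]
  rw [circleIntegral.integral_add h1 h2]
  simp only [mul_left_comm _ a, mul_left_comm _ b]
  rw [circleIntegral.integral_const_mul, circleIntegral.integral_const_mul]
  ring

theorem norm_cauchyCoeff_le (hρ : 0 < ρ) (n : ℕ) {B : ℝ}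
    (hB : ∀ z, ‖z‖ = ρ → ‖f z‖ ≤ B) : ‖cauchyCoeff ρ n f‖ ≤ B * (ρ⁻¹) ^ n := by
  have h := circleIntegral.norm_two_pi_i_inv_smul_integral_le_of_norm_le_const
    (f := fun z => (z⁻¹) ^ (n + 1) * f z) (c := 0) (C := (ρ⁻¹) ^ (n + 1) * B) hρ.le
    (fun z hz => by
      have hz : ‖z‖ = ρ := by simpa using hz
      rw [norm_mul, norm_pow, norm_inv, hz]
      exact mul_le_mul_of_nonneg_left (hB z hz) (by positivity))
  refine h.trans_eq ?_
  rw [pow_succ]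
  field_simp

theorem hasSum_cauchyCoeff (hρ : 0 < ρ) (hf : DifferentiableOn ℂ f (Metric.closedBall 0 ρ))
    {w : ℂ} (hw : ‖w‖ < ρ) : HasSum (fun n => cauchyCoeff ρ n f * w ^ n) (f w) := by
  lift ρ to NNReal using hρ.le
  have h := (hf.hasFPowerSeriesOnBall hρ).hasSum (y := w) (by simpa using hw)
  rw [zero_add] at h
  have heq : (fun n => cauchyCoeff ρ n f * w ^ n) =
      fun n => cauchyPowerSeries f 0 ρ n fun _ => w := by
    ext n
    rw [cauchyPowerSeries_apply, cauchyCoeff, smul_eq_mul, mul_assoc, mul_comm _ (w ^ n),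
      ← circleIntegral.integral_const_mul]
    congr 2
    ext z
    simp only [sub_zero, smul_eq_mul]
    ring
  rwa [heq]

end CauchyCoeff

section UpperBound

variable {α β : ℝ} {u φ : ℂ → ℂ}

theorem MemWeighted.sum {ι : Type*} {F : Finset ι} {h : ι → ℂ → ℂ}
    (hh : ∀ i ∈ F, MemWeighted β (h i)) : MemWeighted β (fun z => ∑ i ∈ F, h i z) :=
  ⟨DifferentiableOn.fun_sum fun i hi => (hh i hi).1, WeightedBdd.sum fun i hi => (hh i hi).2⟩

theorem MemWeighted.const_mul {g : ℂ → ℂ} (hg : MemWeighted β g) (a : ℂ) :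
    MemWeighted β (fun z => a * g z) :=
  ⟨hg.1.const_mul a, WeightedBdd.const_mul hg.2 a⟩

theorem wnorm_lincomb_le {N : ℕ} {g : Fin N → ℂ → ℂ} (hg : ∀ i, MemWeighted β (g i))
    (y : Fin N → ℂ) {B : ℝ} (hy : ∀ i, ‖y i‖ ≤ B) :
    wnorm β (fun z => ∑ i, y i * g i z) ≤ B * ∑ i, wnorm β (g i) := by
  refine (wnorm_sum_le fun i _ => WeightedBdd.const_mul (hg i).2 (y i)).trans ?_
  rw [Finset.mul_sum]
  refine Finset.sum_le_sum fun i _ => ?_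
  rw [wnorm_const_mul]
  exact mul_le_mul_of_nonneg_right (hy i) (wnorm_nonneg _ _)

/-- Bounded finite-rank operators are compact. -/
theorem isCompactOpToWeighted_of_finiteRank {N : ℕ} (A : Fin N → (ℂ → ℂ) → ℂ)
    (g : Fin N → ℂ → ℂ) (hg : ∀ i, MemWeighted β (g i))
    (hlin : ∀ i f h, MemBloch α f → MemBloch α h → ∀ a b : ℂ,
      A i (fun z => a * f z + b * h z) = a * A i f + b * A i h)
    {B : ℝ} (hB0 : 0 ≤ B) (hB : ∀ i f, MemBloch α f → ‖A i f‖ ≤ B * blochNorm α f) :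
    IsCompactOpToWeighted α β (fun f z => ∑ i, A i f * g i z) := by
  refine ⟨fun f h hf hh a b => ?_, fun f _ => .sum fun i _ => (hg i).const_mul _,
    ⟨B * ∑ i, wnorm β (g i), fun f hf => ?_⟩, fun ε hε => ?_⟩
  · ext z
    simp only [hlin _ f h hf hh a b, Finset.mul_sum, ← Finset.sum_add_distrib]
    exact Finset.sum_congr rfl fun i _ => by ring
  · refine (wnorm_lincomb_le hg _ fun i => hB i f hf).trans_eq ?_
    ring
  · classical
    set G := ∑ i, wnorm β (g i)
    have hG : 0 ≤ G := Finset.sum_nonneg fun i _ => wnorm_nonneg _ _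
    obtain ⟨t, ht, hcov⟩ := Metric.totallyBounded_iff.1
      (isCompact_closedBall (0 : Fin N → ℂ) B).totallyBounded (ε / (G + 1)) (by positivity)
    refine ⟨ht.toFinset.image fun y z => ∑ i, y i * g i z, ?_, fun f hf hf1 => ?_⟩
    · intro h hh
      obtain ⟨y, -, rfl⟩ := Finset.mem_image.1 hh
      exact .sum fun i _ => (hg i).const_mul _
    · have hmem : (fun i => A i f) ∈ Metric.closedBall (0 : Fin N → ℂ) B := by
        rw [mem_closedBall_zero_iff, pi_norm_le_iff_of_nonneg hB0]
        exact fun i => (hB i f hf).trans (mul_le_of_le_one_right hB0 hf1)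
      obtain ⟨y, hy, hfy⟩ := mem_iUnion₂.1 (hcov hmem)
      refine ⟨_, Finset.mem_image_of_mem _ (ht.mem_toFinset.2 hy), ?_⟩
      rw [Metric.mem_ball, dist_eq_norm] at hfy
      have h := wnorm_lincomb_le hg ((fun i => A i f) - y)
        fun i => (norm_le_pi_norm _ i).trans hfy.le
      simp only [Pi.sub_apply, sub_mul, Finset.sum_sub_distrib] at h
      refine h.trans ?_
      rw [div_mul_eq_mul_div, div_le_iff₀ (by positivity)]
      exact mul_le_mul_of_nonneg_left (by linarith) hε.le

theorem memBloch_one (α : ℝ) : MemBloch α (fun _ => 1) :=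
  ⟨differentiableOn_const _, WeightedBdd.of_le (c := 0) fun z _ => by simp⟩

theorem BoundedBlochToWeighted.memWeighted_left (hb : BoundedBlochToWeighted α β u φ) :
    MemWeighted β u := by
  have h := hb.1 _ (memBloch_one α)
  unfold wcomp at h
  simpa only [mul_one] using h

theorem norm_pow_le_one_of_mapsTo (hm : MapsTo φ unitDisk unitDisk) (n : ℕ) {z : ℂ}
    (hz : z ∈ unitDisk) : ‖φ z ^ n‖ ≤ 1 := by
  rw [norm_pow]
  exact pow_le_one₀ (norm_nonneg _) (mem_unitDisk_iff.1 (hm hz)).le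

theorem MemWeighted.mul_pow (hu : MemWeighted β u) (hφ : DifferentiableOn ℂ φ unitDisk)
    (hm : MapsTo φ unitDisk unitDisk) (n : ℕ) : MemWeighted β (fun z => u z * φ z ^ n) := by
  refine ⟨hu.1.mul (hφ.pow n), WeightedBdd.of_le (c := wnorm β u) fun z hz => ?_⟩
  refine le_trans ?_ (WeightedBdd.le_wnorm hu.2 hz)
  rw [norm_mul]
  exact mul_le_mul_of_nonneg_left
    (mul_le_of_le_one_right (norm_nonneg _) (norm_pow_le_one_of_mapsTo hm n hz))
    (weight_nonneg β hz)

theorem essNormW_le {K : (ℂ → ℂ) → ℂ → ℂ} (hK : IsCompactOpToWeighted α β K) {c : ℝ} (hc : 0 ≤ c)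
    (h : ∀ f, MemBloch α f → blochNorm α f ≤ 1 →
      wnorm β (fun z => wcomp u φ f z - K f z) ≤ c) : essNormW α β u φ ≤ c := by
  have hle : sSup {s | ∃ f, MemBloch α f ∧ blochNorm α f ≤ 1 ∧
      s = wnorm β (fun z => wcomp u φ f z - K f z)} ≤ c := by
    refine Real.sSup_le ?_ hc
    rintro _ ⟨f, hf, hf1, rfl⟩
    exact h f hf hf1
  refine le_trans (csInf_le ⟨0, ?_⟩ ⟨K, hK, rfl⟩) hle
  rintro _ ⟨K', -, rfl⟩
  refine Real.sSup_nonneg ?_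
  rintro _ ⟨f, -, -, rfl⟩
  exact wnorm_nonneg _ _

theorem exp_neg_two_le_one_sub_pow {t : ℝ} (h0 : 0 ≤ t) (ht : t ≤ 1 / 2) {n : ℕ} (hn : n * t ≤ 1) :
    Real.exp (-2) ≤ (1 - t) ^ n := by
  have h1 : Real.exp (-(2 * t)) ≤ 1 - t := by
    rw [Real.exp_neg, inv_le_comm₀ (Real.exp_pos _) (by linarith)]
    refine le_trans ?_ (Real.add_one_le_exp (2 * t))
    rw [inv_le_iff_one_le_mul₀ (by linarith)]
    nlinarith
  calc Real.exp (-2) ≤ Real.exp (n * -(2 * t)) := Real.exp_le_exp.2 (by nlinarith)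
    _ = Real.exp (-(2 * t)) ^ n := Real.exp_nat_mul _ _
    _ ≤ _ := pow_le_pow_left₀ (Real.exp_pos _).le h1 n

theorem exists_weight_mul_rpow_le (hα : 1 < α) (hu : MemWeighted β u)
    (hφ : DifferentiableOn ℂ φ unitDisk) (hm : MapsTo φ unitDisk unitDisk) {L : ℝ}
    (hL : ∀ᶠ n : ℕ in atTop, ((n : ℝ) + 1) ^ (α - 1) * wnorm β (fun z => u z * φ z ^ n) ≤ L) :
    ∃ s, 0 < s ∧ s < 1 ∧ ∀ z ∈ unitDisk, s < ‖φ z‖ →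
      (1 - ‖z‖ ^ 2) ^ β * ‖u z‖ * (1 - ‖φ z‖) ^ (1 - α) ≤ Real.exp 2 * L := by
  obtain ⟨N, hN⟩ := eventually_atTop.1 hL
  have hNpos : (0 : ℝ) < N + 2 := by positivity
  have hN2 : 1 / ((N : ℝ) + 2) ≤ 1 / 2 :=
    one_div_le_one_div_of_le (by norm_num) (by linarith [Nat.cast_nonneg (α := ℝ) N])
  refine ⟨1 - 1 / (N + 2), by linarith, by linarith [one_div_pos.2 hNpos], fun z hz hs => ?_⟩
  set t := 1 - ‖φ z‖ with ht
  have ht0 : 0 < t := by linarith [mem_unitDisk_iff.1 (hm hz)]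
  have ht1 : t < 1 / (N + 2) := by linarith
  set n := ⌊1 / t⌋₊ with hn
  have hnt : (n : ℝ) ≤ 1 / t := Nat.floor_le (by positivity)
  have hnt' : 1 / t < n + 1 := Nat.lt_floor_add_one _
  have hNn : N ≤ n := by
    refine Nat.le_floor ?_
    rw [lt_div_iff₀ hNpos] at ht1
    rw [le_div_iff₀ ht0]
    nlinarith
  have hpow : Real.exp (-2) ≤ ‖φ z‖ ^ n := by
    have := exp_neg_two_le_one_sub_pow (t := t) ht0.le (by linarith) (n := n)
      (by rwa [le_div_iff₀ ht0] at hnt)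
    rwa [ht, sub_sub_cancel] at this
  have hrp : t ^ (1 - α) ≤ ((n : ℝ) + 1) ^ (α - 1) := by
    rw [← neg_sub α 1, Real.rpow_neg ht0.le, ← Real.inv_rpow ht0.le, inv_eq_one_div]
    exact Real.rpow_le_rpow (by positivity) hnt'.le (by linarith)
  have hW : 0 ≤ (1 - ‖z‖ ^ 2) ^ β * ‖u z‖ := mul_nonneg (weight_nonneg β hz) (norm_nonneg _)
  have h1 : (1 - ‖z‖ ^ 2) ^ β * ‖u z‖ * ‖φ z‖ ^ n ≤ wnorm β (fun z => u z * φ z ^ n) := by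
    have := WeightedBdd.le_wnorm (hu.mul_pow hφ hm n).2 hz
    simpa [mul_assoc] using this
  calc (1 - ‖z‖ ^ 2) ^ β * ‖u z‖ * t ^ (1 - α)
      ≤ (1 - ‖z‖ ^ 2) ^ β * ‖u z‖ * ((n : ℝ) + 1) ^ (α - 1) :=
        mul_le_mul_of_nonneg_left hrp hW
    _ = Real.exp 2 * (((n : ℝ) + 1) ^ (α - 1) *
          ((1 - ‖z‖ ^ 2) ^ β * ‖u z‖ * Real.exp (-2))) := by
        rw [Real.exp_neg]
        field_simp
    _ ≤ Real.exp 2 * (((n : ℝ) + 1) ^ (α - 1) * wnorm β (fun z => u z * φ z ^ n)) := by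
        gcongr
        exact (mul_le_mul_of_nonneg_left hpow hW).trans h1
    _ ≤ Real.exp 2 * L := by
        gcongr
        exact hN n hNn

/-- Finite-rank truncation of `f ↦ u · f(r φ)`. -/
def truncOp (u φ : ℂ → ℂ) (r ρ : ℝ) (N : ℕ) (f : ℂ → ℂ) (z : ℂ) : ℂ :=
  ∑ i : Fin N, (cauchyCoeff ρ i f * (r : ℂ) ^ (i : ℕ)) * (u z * φ z ^ (i : ℕ))

theorem MemBloch.continuousOn_sphere {f : ℂ → ℂ} (hf : MemBloch α f) {ρ : ℝ} (hρ : ρ < 1) :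
    ContinuousOn f (Metric.sphere 0 ρ) :=
  hf.1.continuousOn.mono fun z hz => by
    rw [mem_unitDisk_iff]
    have : ‖z‖ = ρ := by simpa using hz
    rwa [this]

theorem isCompactOpToWeighted_truncOp (hα : 1 < α) (hu : MemWeighted β u)
    (hφ : DifferentiableOn ℂ φ unitDisk) (hm : MapsTo φ unitDisk unitDisk) {r ρ : ℝ}
    (hr0 : 0 ≤ r) (hrρ : r < ρ) (hρ : ρ < 1) (N : ℕ) :
    IsCompactOpToWeighted α β (truncOp u φ r ρ N) := by
  have hα' : 0 < α - 1 := by linarith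
  have hρ0 : 0 < ρ := hr0.trans_lt hrρ
  have hB : 0 ≤ 1 + (1 - ρ) ^ (1 - α) / (α - 1) :=
    add_nonneg zero_le_one (div_nonneg (Real.rpow_nonneg (by linarith) _) hα'.le)
  refine isCompactOpToWeighted_of_finiteRank
    (fun i f => cauchyCoeff ρ i f * (r : ℂ) ^ (i : ℕ)) _
    (fun i => hu.mul_pow hφ hm i) (fun i f h hf hh a b => ?_) hB (fun i f hf => ?_)
  · simp only [cauchyCoeff_lincomb hρ0 i (hf.continuousOn_sphere hρ) (hh.continuousOn_sphere hρ)]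
    ring
  · have h := norm_cauchyCoeff_le hρ0 i fun z hz => hf.norm_le hα hz.le hρ
    rw [norm_mul, norm_pow, Complex.norm_real, Real.norm_of_nonneg hr0]
    refine (mul_le_mul_of_nonneg_right h (pow_nonneg hr0 _)).trans ?_
    rw [mul_assoc, ← mul_pow]
    refine mul_le_of_le_one_right (mul_nonneg hB (blochNorm_nonneg _ _))
      (pow_le_one₀ (by positivity) ?_)
    rw [inv_mul_le_iff₀ hρ0]
    linarith

theorem norm_sub_truncOp_le (hα : 1 < α) (hm : MapsTo φ unitDisk unitDisk) {r ρ : ℝ}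
    (hr0 : 0 ≤ r) (hrρ : r < ρ) (hρ : ρ < 1) (N : ℕ) {f : ℂ → ℂ} (hf : MemBloch α f)
    (hf1 : blochNorm α f ≤ 1) {z : ℂ} (hz : z ∈ unitDisk) :
    ‖u z * f (r * φ z) - truncOp u φ r ρ N f z‖ ≤
      ‖u z‖ * ((1 + (1 - ρ) ^ (1 - α) / (α - 1)) * (r / ρ) ^ N / (1 - r / ρ)) := by
  have hα' : 0 < α - 1 := by linarith
  have hρ0 : 0 < ρ := hr0.trans_lt hrρ
  have hB : 0 ≤ 1 + (1 - ρ) ^ (1 - α) / (α - 1) :=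
    add_nonneg zero_le_one (div_nonneg (Real.rpow_nonneg (by linarith) _) hα'.le)
  have hφz : ‖φ z‖ < 1 := mem_unitDisk_iff.1 (hm hz)
  have hnorm : ‖(r : ℂ) * φ z‖ ≤ r := by
    rw [norm_mul, Complex.norm_real, Real.norm_of_nonneg hr0]
    exact mul_le_of_le_one_right hr0 hφz.le
  have hd : DifferentiableOn ℂ f (Metric.closedBall 0 ρ) := hf.1.mono fun w hw =>
    mem_unitDisk_iff.2 ((mem_closedBall_zero_iff.1 hw).trans_lt hρ)
  have hs := hasSum_cauchyCoeff hρ0 hd (hnorm.trans_lt hrρ)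
  have h := norm_sub_le_of_geometric_bound_of_hasSum ((div_lt_one hρ0).2 hrρ) (fun n => ?_) hs N
    (C := 1 + (1 - ρ) ^ (1 - α) / (α - 1))
  · have heq : u z * f (r * φ z) - truncOp u φ r ρ N f z =
        -(u z * (∑ n ∈ Finset.range N, cauchyCoeff ρ n f * (r * φ z) ^ n - f (r * φ z))) := by
      rw [truncOp, Fin.sum_univ_eq_sum_range
        (fun i => (cauchyCoeff ρ i f * (r : ℂ) ^ i) * (u z * φ z ^ i)), mul_sub, Finset.mul_sum,
        neg_sub]
      congr 1
      exact Finset.sum_congr rfl fun i _ => by ring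
    rw [heq, norm_neg, norm_mul]
    exact mul_le_mul_of_nonneg_left h (norm_nonneg _)
  · have h := norm_cauchyCoeff_le hρ0 n fun z hz => (hf.norm_le hα hz.le hρ).trans
      (mul_le_of_le_one_right hB hf1)
    rw [norm_mul, norm_pow, div_eq_inv_mul r ρ, mul_pow, ← mul_assoc]
    exact mul_le_mul h (pow_le_pow_left₀ (norm_nonneg _) hnorm n) (by positivity) (by positivity)

theorem essNormW_le_of_eventually_le (hα : 1 < α) (hu : MemWeighted β u)
    (hφ : DifferentiableOn ℂ φ unitDisk) (hm : MapsTo φ unitDisk unitDisk) {L : ℝ} (hL0 : 0 ≤ L)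
    (hL : ∀ᶠ n : ℕ in atTop, ((n : ℝ) + 1) ^ (α - 1) * wnorm β (fun z => u z * φ z ^ n) ≤ L) :
    essNormW α β u φ ≤ Real.exp 2 / (α - 1) * L := by
  have hα' : 0 < α - 1 := by linarith
  have hC : 0 ≤ Real.exp 2 / (α - 1) * L := by positivity
  obtain ⟨s, hs0, hs1, hs⟩ := exists_weight_mul_rpow_le hα hu hφ hm hL
  set U := wnorm β u
  have hU : 0 ≤ U := wnorm_nonneg _ _
  refine le_of_forall_pos_le_add fun ε hε => ?_
  obtain ⟨r, hr0, hr1, hr⟩ : ∃ r, 0 < r ∧ r < 1 ∧ U * ((1 - s) ^ (-α) * (1 - r)) ≤ ε / 2 := by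
    have hcont : Tendsto (fun r : ℝ => U * ((1 - s) ^ (-α) * (1 - r))) (nhdsWithin 1 (Iio 1)) (nhds 0) := by
      have : Continuous fun r : ℝ => U * ((1 - s) ^ (-α) * (1 - r)) := by fun_prop
      simpa using (this.tendsto 1).mono_left nhdsWithin_le_nhds
    have h0 : ∀ᶠ r : ℝ in nhdsWithin 1 (Iio 1), r ∈ Ioo (0 : ℝ) 1 := Ioo_mem_nhdsLT zero_lt_one
    obtain ⟨r, hr, hr'⟩ := ((hcont.eventually (gt_mem_nhds (half_pos hε))).and h0).exists
    exact ⟨r, hr'.1, hr'.2, hr.le⟩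
  obtain ⟨ρ, hrρ, hρ⟩ := exists_between hr1
  have hρ0 : 0 < ρ := hr0.trans hrρ
  have hq : r / ρ < 1 := (div_lt_one hρ0).2 hrρ
  set B := 1 + (1 - ρ) ^ (1 - α) / (α - 1)
  obtain ⟨N, hN⟩ : ∃ N : ℕ, U * (B * (r / ρ) ^ N / (1 - r / ρ)) ≤ ε / 2 := by
    have h := (((tendsto_pow_atTop_nhds_zero_of_lt_one (by positivity) hq).const_mul B).div_const
      (1 - r / ρ)).const_mul U
    simp only [mul_zero, zero_div] at h
    obtain ⟨N, hN⟩ := (h.eventually (gt_mem_nhds (half_pos hε))).exists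
    exact ⟨N, hN.le⟩
  refine essNormW_le (isCompactOpToWeighted_truncOp hα hu hφ hm hr0.le hrρ hρ N)
    (by linarith) fun f hf hf1 => wnorm_le fun z hz => ?_
  have hW := weight_nonneg β hz
  have hWu : (1 - ‖z‖ ^ 2) ^ β * ‖u z‖ ≤ U := WeightedBdd.le_wnorm hu.2 hz
  have hWu0 : 0 ≤ (1 - ‖z‖ ^ 2) ^ β * ‖u z‖ := mul_nonneg hW (norm_nonneg _)
  have hφz : ‖φ z‖ < 1 := mem_unitDisk_iff.1 (hm hz)
  have hS1 : wnorm α (deriv f) ≤ 1 := by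
    have := norm_nonneg (f 0)
    rw [blochNorm] at hf1
    linarith
  have hS0 : 0 ≤ wnorm α (deriv f) := wnorm_nonneg _ _
  have htail : (1 - ‖z‖ ^ 2) ^ β * ‖u z * f (r * φ z) - truncOp u φ r ρ N f z‖ ≤ ε / 2 := by
    refine (mul_le_mul_of_nonneg_left
      (norm_sub_truncOp_le hα hm hr0.le hrρ hρ N hf hf1 hz) hW).trans ?_
    rw [← mul_assoc]
    refine (mul_le_mul_of_nonneg_right hWu ?_).trans hN
    have : 0 < 1 - r / ρ := by linarith
    have hB : 0 ≤ B := add_nonneg zero_le_one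
      (div_nonneg (Real.rpow_nonneg (by linarith) _) hα'.le)
    positivity
  have hhead : (1 - ‖z‖ ^ 2) ^ β * ‖u z * (f (φ z) - f (r * φ z))‖ ≤
      Real.exp 2 / (α - 1) * L + ε / 2 := by
    rw [norm_mul, ← mul_assoc]
    rcases le_or_gt ‖φ z‖ s with hle | hgt
    · have h := hf.norm_sub_le_of_norm_le (by linarith) hle hs1 hr0.le hr1.le
      have hp : 0 ≤ (1 - s) ^ (-α) * (1 - r) :=
        mul_nonneg (Real.rpow_nonneg (by linarith) _) (by linarith)
      have h' : ‖f (φ z) - f (r * φ z)‖ ≤ (1 - s) ^ (-α) * (1 - r) := by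
        refine h.trans ?_
        rw [mul_assoc]
        exact mul_le_of_le_one_left hp hS1
      have := mul_le_mul hWu h' (norm_nonneg _) hU
      linarith
    · have h := hf.norm_sub_radial_le hα hφz hr0.le hr1.le
      have hp : 0 ≤ (1 - ‖φ z‖) ^ (1 - α) / (α - 1) :=
        div_nonneg (Real.rpow_nonneg (by linarith) _) hα'.le
      have h' := h.trans (mul_le_of_le_one_left hp hS1)
      have h2 := div_le_div_of_nonneg_right (hs z hz hgt) hα'.le
      calc _ ≤ (1 - ‖z‖ ^ 2) ^ β * ‖u z‖ * ((1 - ‖φ z‖) ^ (1 - α) / (α - 1)) :=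
            mul_le_mul_of_nonneg_left h' hWu0
        _ = (1 - ‖z‖ ^ 2) ^ β * ‖u z‖ * (1 - ‖φ z‖) ^ (1 - α) / (α - 1) := by ring
        _ ≤ Real.exp 2 * L / (α - 1) := h2
        _ = Real.exp 2 / (α - 1) * L := by ring
        _ ≤ _ := by linarith
  have hsplit : wcomp u φ f z - truncOp u φ r ρ N f z =
      u z * (f (φ z) - f (r * φ z)) + (u z * f (r * φ z) - truncOp u φ r ρ N f z) := by
    rw [wcomp]
    ring
  rw [hsplit]
  calc _ ≤ (1 - ‖z‖ ^ 2) ^ β * (‖u z * (f (φ z) - f (r * φ z))‖ +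
        ‖u z * f (r * φ z) - truncOp u φ r ρ N f z‖) :=
        mul_le_mul_of_nonneg_left (norm_add_le _ _) hW
    _ ≤ _ := by
        rw [mul_add]
        linarith

end UpperBound

section Monomials

/-- `(n+1)^(α-1)` times the weighted derivative of `z ^ n` on `|z| = x`. -/
def monomialProfile (α : ℝ) (n : ℕ) (x : ℝ) : ℝ :=
  ((n : ℝ) + 1) ^ (α - 1) * (n * x ^ (n - 1)) * (1 - x ^ 2) ^ α

/-- A uniform bound for `monomialProfile α`. -/
def profileBound (α : ℝ) : ℝ := 2 ^ α * α ^ α * Real.exp 2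

variable {α : ℝ}

theorem profileBound_pos (hα : 0 < α) : 0 < profileBound α := by
  unfold profileBound
  positivity

theorem rpow_le_rpow_mul_exp (hα : 0 < α) {y : ℝ} (hy : 0 ≤ y) :
    y ^ α ≤ α ^ α * Real.exp y := by
  have h : y ≤ α * Real.exp (y / α) := by
    have := Real.add_one_le_exp (y / α)
    calc y = α * (y / α) := by field_simp
      _ ≤ _ := by gcongr; linarith
  calc y ^ α ≤ (α * Real.exp (y / α)) ^ α := Real.rpow_le_rpow hy h hα.le
    _ = α ^ α * Real.exp y := by
      rw [Real.mul_rpow hα.le (Real.exp_pos _).le, ← Real.exp_mul, div_mul_cancel₀ _ hα.ne']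

theorem monomialProfile_le (hα : 0 < α) (n : ℕ) {x : ℝ} (h0 : 0 ≤ x) (h1 : x ≤ 1) :
    monomialProfile α n x ≤ profileBound α := by
  rcases n.eq_zero_or_pos with rfl | hn
  · simpa [monomialProfile] using (profileBound_pos hα).le
  have hn1 : (1 : ℝ) ≤ n := by exact_mod_cast hn
  set t := 1 - x with ht
  have ht0 : 0 ≤ t := by linarith
  set y := ((n : ℝ) + 1) * t with hy
  have hy0 : 0 ≤ y := by positivity
  have hw : (1 - x ^ 2) ^ α ≤ 2 ^ α * t ^ α := by
    rw [← Real.mul_rpow zero_le_two ht0]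
    exact Real.rpow_le_rpow (by nlinarith) (by nlinarith) hα.le
  have hn' : ((n : ℝ) + 1) ^ (α - 1) * n ≤ ((n : ℝ) + 1) ^ α := by
    rw [Real.rpow_sub_one (by positivity), div_mul_eq_mul_div, div_le_iff₀ (by positivity)]
    gcongr
    linarith
  have hx : x ^ (n - 1) ≤ Real.exp (-y) * Real.exp 2 := by
    have hxe : x ≤ Real.exp (-t) := by
      have := Real.add_one_le_exp (-t)
      linarith
    calc x ^ (n - 1) ≤ Real.exp (-t) ^ (n - 1) := pow_le_pow_left₀ h0 hxe _
      _ = Real.exp (((n - 1 : ℕ) : ℝ) * -t) := (Real.exp_nat_mul _ _).symm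
      _ ≤ Real.exp (-y + 2) := by
        refine Real.exp_le_exp.2 ?_
        rw [Nat.cast_sub hn, hy]
        push_cast
        nlinarith
      _ = _ := Real.exp_add _ _
  have hyt : ((n : ℝ) + 1) ^ α * t ^ α = y ^ α := (Real.mul_rpow (by positivity) ht0).symm
  have hw0 : 0 ≤ (1 - x ^ 2) ^ α := Real.rpow_nonneg (by nlinarith) _
  calc monomialProfile α n x
      = (((n : ℝ) + 1) ^ (α - 1) * n) * x ^ (n - 1) * (1 - x ^ 2) ^ α := by
        rw [monomialProfile]
        ring
    _ ≤ ((n : ℝ) + 1) ^ α * (Real.exp (-y) * Real.exp 2) * (2 ^ α * t ^ α) := by gcongr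
    _ = 2 ^ α * y ^ α * Real.exp (-y) * Real.exp 2 := by
        rw [← hyt]
        ring
    _ ≤ 2 ^ α * (α ^ α * Real.exp y) * Real.exp (-y) * Real.exp 2 := by
        gcongr
        exact rpow_le_rpow_mul_exp hα hy0
    _ = profileBound α := by
        rw [profileBound, Real.exp_neg]
        field_simp

theorem eventually_monomialProfile_le (hα : 0 < α) {r : ℝ} (hr0 : 0 ≤ r) (hr1 : r < 1) {δ : ℝ}
    (hδ : 0 < δ) : ∀ᶠ n : ℕ in atTop, ∀ x, 0 ≤ x → x ≤ r → monomialProfile α n x ≤ δ := by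
  obtain ⟨ρ, hrρ, hρ⟩ := exists_between hr1
  have hρ0 : 0 < ρ := hr0.trans_lt hrρ
  have hρ2 : 0 < 1 - ρ ^ 2 := by nlinarith
  set D := profileBound α / (1 - ρ ^ 2) ^ α
  have hlim : Tendsto (fun n : ℕ => D * (r / ρ) ^ (n - 1)) atTop (nhds 0) := by
    simpa using ((tendsto_pow_atTop_nhds_zero_of_lt_one (by positivity)
      ((div_lt_one hρ0).2 hrρ)).comp (tendsto_sub_atTop_nat 1)).const_mul D
  filter_upwards [hlim.eventually (gt_mem_nhds hδ)] with n hn x hx0 hxr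
  refine le_trans ?_ hn.le
  have hw : (1 - x ^ 2) ^ α ≤ 1 :=
    Real.rpow_le_one (by nlinarith) (by nlinarith [sq_nonneg x]) hα.le
  have hwρ : 0 < (1 - ρ ^ 2) ^ α := Real.rpow_pos_of_pos hρ2 _
  have hD : ((n : ℝ) + 1) ^ (α - 1) * (n * ρ ^ (n - 1)) ≤ D := by
    rw [le_div_iff₀ hwρ]
    exact monomialProfile_le hα n hρ0.le hρ.le
  calc monomialProfile α n x
      ≤ ((n : ℝ) + 1) ^ (α - 1) * (n * r ^ (n - 1)) * 1 := by
        unfold monomialProfile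
        gcongr
        exact Real.rpow_nonneg (by nlinarith) _
    _ = ((n : ℝ) + 1) ^ (α - 1) * (n * ρ ^ (n - 1)) * (r / ρ) ^ (n - 1) := by
        rw [div_pow]
        field_simp
    _ ≤ D * (r / ρ) ^ (n - 1) := by gcongr

theorem continuous_monomialProfile (hα : 0 < α) (n : ℕ) : Continuous (monomialProfile α n) := by
  unfold monomialProfile
  exact (by fun_prop : Continuous fun x : ℝ => ((n : ℝ) + 1) ^ (α - 1) * (n * x ^ (n - 1))).mul
    ((by fun_prop : Continuous fun x : ℝ => 1 - x ^ 2).rpow_const fun _ => Or.inr hα.le)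

/-- Gliding hump: sparse sums of monomial profiles stay bounded. -/
theorem exists_finset_sum_monomialProfile_le (hα : 0 < α) {A : Set ℕ} (hA : A.Infinite) {δ : ℝ}
    (hδ : 0 < δ) (N : ℕ) : ∃ F : Finset ℕ, (F : Set ℕ) ⊆ A ∧ F.card = N ∧
      ∀ x, 0 ≤ x → x < 1 → ∑ n ∈ F, monomialProfile α n x ≤ profileBound α + N * δ := by
  induction N with
  | zero => exact ⟨∅, by simp, rfl, fun x _ _ => by simpa using (profileBound_pos hα).le⟩
  | succ N ih =>
    obtain ⟨F, hFA, hFN, hF⟩ := ih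
    obtain ⟨r, hr0, hr1, hr⟩ : ∃ r, 0 ≤ r ∧ r < 1 ∧
        ∀ x, r < x → x < 1 → ∑ n ∈ F, monomialProfile α n x ≤ δ := by
      have hc : Continuous fun x => ∑ n ∈ F, monomialProfile α n x :=
        continuous_finsetSum _ fun n _ => continuous_monomialProfile hα n
      have h1 : ∑ n ∈ F, monomialProfile α n 1 = 0 :=
        Finset.sum_eq_zero fun n _ => by simp [monomialProfile, Real.zero_rpow hα.ne']
      have hev : ∀ᶠ x in nhdsWithin 1 (Iio 1), ∑ n ∈ F, monomialProfile α n x < δ :=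
        ((hc.tendsto 1).mono_left nhdsWithin_le_nhds).eventually (gt_mem_nhds (by rwa [h1]))
      obtain ⟨r, hr, hsub⟩ := (mem_nhdsLT_iff_exists_mem_Ico_Ioo_subset (zero_lt_one' ℝ)).1 hev
      exact ⟨r, hr.1, hr.2, fun x hx hx1 => (hsub ⟨hx, hx1⟩).le⟩
    obtain ⟨m, hm⟩ := eventually_atTop.1 (eventually_monomialProfile_le hα hr0 hr1 hδ)
    obtain ⟨n, hnA, hn⟩ := hA.exists_gt (max m (F.sup id))
    have hnF : n ∉ F := fun h =>
      absurd ((le_max_right _ _).trans_lt hn) (not_lt.2 (Finset.le_sup (f := id) h))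
    have hnm : m ≤ n := (le_max_left _ _).trans hn.le
    refine ⟨insert n F, ?_, by rw [Finset.card_insert_of_notMem hnF, hFN], fun x hx0 hx1 => ?_⟩
    · rw [Finset.coe_insert]
      exact insert_subset hnA hFA
    · rw [Finset.sum_insert hnF]
      push_cast
      rcases le_or_gt x r with hxr | hxr
      · linarith [hm n hnm x hx0 hxr, hF x hx0 hx1]
      · have hNδ : 0 ≤ (N : ℝ) * δ := by positivity
        linarith [monomialProfile_le hα n hx0 hx1.le, hr x hxr hx1]

/-- The normalized monomials. -/
def normalizedMonomial (α : ℝ) (n : ℕ) (z : ℂ) : ℂ :=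
  (((profileBound α)⁻¹ * ((n : ℝ) + 1) ^ (α - 1) : ℝ) : ℂ) * z ^ n

theorem deriv_sum_normalizedMonomial (α : ℝ) (F : Finset ℕ) (z : ℂ) :
    deriv (fun z => ∑ n ∈ F, normalizedMonomial α n z) z =
      ∑ n ∈ F, (((profileBound α)⁻¹ * ((n : ℝ) + 1) ^ (α - 1) : ℝ) : ℂ) *
        ((n : ℂ) * z ^ (n - 1)) :=
  (HasDerivAt.fun_sum fun n _ => (hasDerivAt_pow n z).const_mul _).deriv

theorem weight_mul_norm_deriv_sum_le (hα : 0 < α) (F : Finset ℕ) {z : ℂ} (hz : z ∈ unitDisk) :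
    (1 - ‖z‖ ^ 2) ^ α * ‖deriv (fun z => ∑ n ∈ F, normalizedMonomial α n z) z‖ ≤
      (profileBound α)⁻¹ * ∑ n ∈ F, monomialProfile α n ‖z‖ := by
  rw [deriv_sum_normalizedMonomial]
  refine (mul_le_mul_of_nonneg_left (norm_sum_le _ _) (weight_nonneg α hz)).trans_eq ?_
  rw [Finset.mul_sum, Finset.mul_sum]
  refine Finset.sum_congr rfl fun n _ => ?_
  have hM := profileBound_pos hα
  rw [norm_mul, norm_mul, norm_pow, Complex.norm_real, Complex.norm_natCast,
    Real.norm_of_nonneg (by positivity), monomialProfile]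
  ring

theorem differentiable_normalizedMonomial (α : ℝ) (n : ℕ) :
    Differentiable ℂ (normalizedMonomial α n) := by
  unfold normalizedMonomial
  fun_prop

theorem memBloch_sum_normalizedMonomial (hα : 0 < α) (F : Finset ℕ) :
    MemBloch α (fun z => ∑ n ∈ F, normalizedMonomial α n z) := by
  refine ⟨(Differentiable.fun_sum fun n _ =>
    differentiable_normalizedMonomial α n).differentiableOn,
    WeightedBdd.of_le (c := (profileBound α)⁻¹ * ∑ n ∈ F, profileBound α) fun z hz =>
      (weight_mul_norm_deriv_sum_le hα F hz).trans ?_⟩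
  have hM := profileBound_pos hα
  gcongr with n _
  exact monomialProfile_le hα n (norm_nonneg _) (mem_unitDisk_iff.1 hz).le

theorem memBloch_normalizedMonomial (hα : 0 < α) (n : ℕ) :
    MemBloch α (normalizedMonomial α n) := by
  simpa using memBloch_sum_normalizedMonomial hα {n}

theorem blochNorm_sum_normalizedMonomial_le (hα : 0 < α) {F : Finset ℕ} (hF : ∀ n ∈ F, 1 ≤ n)
    {c : ℝ} (hc : ∀ x, 0 ≤ x → x < 1 → ∑ n ∈ F, monomialProfile α n x ≤ profileBound α * c) :
    blochNorm α (fun z => ∑ n ∈ F, normalizedMonomial α n z) ≤ c := by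
  have h0 : ∑ n ∈ F, normalizedMonomial α n 0 = 0 := Finset.sum_eq_zero fun n hn => by
    simp [normalizedMonomial, (Nat.one_le_iff_ne_zero.1 (hF n hn))]
  have hM := profileBound_pos hα
  rw [blochNorm, h0, norm_zero, zero_add]
  refine wnorm_le fun z hz => (weight_mul_norm_deriv_sum_le hα F hz).trans ?_
  rw [inv_mul_le_iff₀ hM]
  exact hc _ (norm_nonneg _) (mem_unitDisk_iff.1 hz)

theorem blochNorm_normalizedMonomial_le (hα : 0 < α) {n : ℕ} (hn : 1 ≤ n) :
    blochNorm α (normalizedMonomial α n) ≤ 1 := by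
  simpa using blochNorm_sum_normalizedMonomial_le hα (F := {n}) (by simpa using hn) (c := 1)
    fun x h0 h1 => by simpa using monomialProfile_le hα n h0 h1.le

theorem wnorm_wcomp_normalizedMonomial (hα : 0 < α) (β : ℝ) (u φ : ℂ → ℂ) (n : ℕ) :
    wnorm β (wcomp u φ (normalizedMonomial α n)) =
      (profileBound α)⁻¹ * (((n : ℝ) + 1) ^ (α - 1) * wnorm β (fun z => u z * φ z ^ n)) := by
  have hM := profileBound_pos hα
  have : wcomp u φ (normalizedMonomial α n) = fun z =>
      (((profileBound α)⁻¹ * ((n : ℝ) + 1) ^ (α - 1) : ℝ) : ℂ) * (u z * φ z ^ n) := by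
    ext z
    rw [wcomp, normalizedMonomial]
    ring
  rw [this, wnorm_const_mul, Complex.norm_real, Real.norm_of_nonneg (by positivity), mul_assoc]

end Monomials

section LowerBound

variable {α β : ℝ} {u φ : ℂ → ℂ} {K : (ℂ → ℂ) → ℂ → ℂ}

theorem IsCompactOpToWeighted.map_sum (hα : 0 < α) (hK : IsCompactOpToWeighted α β K)
    (F : Finset ℕ) : K (fun z => ∑ n ∈ F, normalizedMonomial α n z) =
      fun z => ∑ n ∈ F, K (normalizedMonomial α n) z := by
  induction F using Finset.induction_on with
  | empty =>
    have h := memBloch_normalizedMonomial hα 0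
    simpa using hK.1 _ _ h h 0 0
  | insert n F hn ih =>
    have h := hK.1 _ _ (memBloch_normalizedMonomial hα n) (memBloch_sum_normalizedMonomial hα F) 1 1
    rw [ih] at h
    simpa [Finset.sum_insert hn] using h

/-- A compact operator is small on infinitely many normalized monomials of any infinite family. -/
theorem IsCompactOpToWeighted.exists_wnorm_le (hα : 0 < α) (hK : IsCompactOpToWeighted α β K)
    {A : Set ℕ} (hA : A.Infinite) {ε : ℝ} (hε : 0 < ε) :
    ∃ n ∈ A, 1 ≤ n ∧ wnorm β (K (normalizedMonomial α n)) ≤ ε := by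
  obtain ⟨-, hmem, ⟨C, hC⟩, htb⟩ := id hK
  have hM := profileBound_pos hα
  set δ := ε / (2 * |C| + 2) with hδ
  have hδ0 : 0 < δ := by positivity
  obtain ⟨T, hT, hTK⟩ := htb δ hδ0
  have hA1 : (A ∩ Ici 1).Infinite := by
    have : A \ Iio 1 = A ∩ Ici 1 := by
      ext n
      simp [Nat.one_le_iff_ne_zero]
    rw [← this]
    exact hA.sdiff (finite_Iio 1)
  obtain ⟨g, hgT, hg⟩ : ∃ g ∈ T, {n ∈ A ∩ Ici 1 |
      wnorm β (fun z => K (normalizedMonomial α n) z - g z) ≤ δ}.Infinite := by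
    by_contra! hcon
    refine hA1 ((T.finite_toSet.biUnion fun g hg => hcon g hg).subset ?_)
    intro n hn
    obtain ⟨g, hg, hgn⟩ := hTK _ (memBloch_normalizedMonomial hα n)
      (blochNorm_normalizedMonomial_le hα hn.2)
    exact mem_iUnion₂.2 ⟨g, hg, hn, hgn⟩
  obtain ⟨N, hN⟩ := exists_nat_gt (1 / δ)
  have hN0 : (0 : ℝ) < N := (one_div_pos.2 hδ0).trans hN
  obtain ⟨F, hFA, hFN, hF⟩ := exists_finset_sum_monomialProfile_le hα hg
    (mul_pos hM hδ0) N
  set P := fun z => ∑ n ∈ F, normalizedMonomial α n z with hP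
  have hPn : blochNorm α P ≤ 1 + N * δ :=
    blochNorm_sum_normalizedMonomial_le hα (fun n hn => (hFA hn).1.2) fun x h0 h1 =>
      (hF x h0 h1).trans_eq (by ring)
  have hKb : ∀ n, WeightedBdd β (K (normalizedMonomial α n)) := fun n =>
    (hmem _ (memBloch_normalizedMonomial hα n)).2
  have hgb : WeightedBdd β g := (hT g hgT).2
  have hdiff : ∀ n ∈ F, WeightedBdd β (fun z => K (normalizedMonomial α n) z - g z) :=
    fun n _ => (hKb n).sub hgb
  have hKP : wnorm β (K P) ≤ |C| * (1 + N * δ) :=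
    (hC P (memBloch_sum_normalizedMonomial hα F)).trans
      ((mul_le_mul_of_nonneg_right (le_abs_self C) (blochNorm_nonneg _ _)).trans
        (mul_le_mul_of_nonneg_left hPn (abs_nonneg C)))
  have hNg : N * wnorm β g ≤ |C| * (1 + N * δ) + N * δ := by
    have heq : (fun z => (N : ℂ) * g z) =
        fun z => K P z - ∑ n ∈ F, (K (normalizedMonomial α n) z - g z) := by
      ext z
      rw [hP, hK.map_sum hα, Finset.sum_sub_distrib, Finset.sum_const, hFN, nsmul_eq_mul]
      ring
    have h1 : wnorm β (fun z => (N : ℂ) * g z) = N * wnorm β g := by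
      rw [wnorm_const_mul, Complex.norm_natCast]
    rw [← h1, heq]
    refine (wnorm_sub_le (hmem P (memBloch_sum_normalizedMonomial hα F)).2
      (WeightedBdd.sum hdiff)).trans (add_le_add hKP ((wnorm_sum_le hdiff).trans ?_))
    refine (Finset.sum_le_card_nsmul F _ δ fun n hn => (hFA hn).2).trans_eq ?_
    rw [hFN, nsmul_eq_mul]
  have h1N : 1 ≤ N * δ := by
    rw [div_lt_iff₀ hδ0] at hN
    exact hN.le
  have hgn : wnorm β g ≤ (2 * |C| + 1) * δ := by
    refine le_of_mul_le_mul_left ?_ hN0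
    nlinarith [abs_nonneg C]
  obtain ⟨n, hnA, hn⟩ := hg.nonempty
  refine ⟨n, hnA.1, hnA.2, (wnorm_le_wnorm_sub_add (hKb n) hgb).trans ?_⟩
  have : (2 * |C| + 2) * δ = ε := by
    rw [hδ]
    field_simp
  linarith

theorem limsup_le_mul_essNormW (hα : 1 < α) (hφ : DifferentiableOn ℂ φ unitDisk)
    (hm : MapsTo φ unitDisk unitDisk) (hb : BoundedBlochToWeighted α β u φ) :
    limsup (fun n : ℕ => ((n : ℝ) + 1) ^ (α - 1) * wnorm β (fun z => u z * φ z ^ n)) atTop ≤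
      profileBound α * essNormW α β u φ := by
  have hα0 : 0 < α := by linarith
  have hM := profileBound_pos hα0
  have hu := hb.memWeighted_left
  rw [← div_le_iff₀' hM]
  refine le_csInf ⟨_, _, isCompactOpToWeighted_truncOp hα hu hφ hm le_rfl
    (by norm_num : (0 : ℝ) < 1 / 2) (by norm_num) 0, rfl⟩ ?_
  rintro _ ⟨K, hK, rfl⟩
  set R := sSup {s | ∃ f, MemBloch α f ∧ blochNorm α f ≤ 1 ∧
      s = wnorm β (fun z => wcomp u φ f z - K f z)}
  have hR : ∀ f, MemBloch α f → blochNorm α f ≤ 1 →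
      wnorm β (fun z => wcomp u φ f z - K f z) ≤ R := by
    obtain ⟨C₁, hC₁, h₁⟩ := hb.2
    obtain ⟨C₂, h₂⟩ := hK.2.2.1
    refine fun f hf hf1 => le_csSup ⟨C₁ + |C₂|, ?_⟩ ⟨f, hf, hf1, rfl⟩
    rintro _ ⟨f, hf, hf1, rfl⟩
    refine (wnorm_sub_le (hb.1 f hf).2 (hK.2.1 f hf).2).trans (add_le_add ?_ ?_)
    · exact (h₁ f hf).trans (mul_le_of_le_one_right hC₁.le hf1)
    · exact (h₂ f hf).trans ((mul_le_mul_of_nonneg_right (le_abs_self _)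
        (blochNorm_nonneg _ _)).trans (mul_le_of_le_one_right (abs_nonneg _) hf1))
  rw [div_le_iff₀' hM]
  refine le_of_forall_pos_le_add fun ε hε => ?_
  set L := limsup (fun n : ℕ => ((n : ℝ) + 1) ^ (α - 1) * wnorm β (fun z => u z * φ z ^ n)) atTop
  have hcob : IsCoboundedUnder (· ≤ ·) atTop
      fun n : ℕ => ((n : ℝ) + 1) ^ (α - 1) * wnorm β (fun z => u z * φ z ^ n) :=
    (isBoundedUnder_of ⟨0, fun n => mul_nonneg (by positivity)
      (wnorm_nonneg _ _)⟩ : IsBoundedUnder (· ≥ ·) atTop _).isCoboundedUnder_le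
  have hfreq := frequently_lt_of_lt_limsup hcob (show L - ε / 2 < L by linarith)
  obtain ⟨n, hnL, hn1, hnK⟩ := hK.exists_wnorm_le hα0 (Nat.frequently_atTop_iff_infinite.1 hfreq)
    (show 0 < ε / (2 * profileBound α) by positivity)
  have hmem := memBloch_normalizedMonomial hα0 n
  have h := (wnorm_le_wnorm_sub_add (hb.1 _ hmem).2 (hK.2.1 _ hmem).2).trans
    (add_le_add (hR _ hmem (blochNorm_normalizedMonomial_le hα0 hn1)) hnK)
  rw [wnorm_wcomp_normalizedMonomial hα0, inv_mul_le_iff₀ hM] at h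
  have heq : profileBound α * (R + ε / (2 * profileBound α)) = profileBound α * R + ε / 2 := by
    field_simp
  rw [heq] at h
  have hnL' : L - ε / 2 < ((n : ℝ) + 1) ^ (α - 1) * wnorm β (fun z => u z * φ z ^ n) := hnL
  linarith

theorem isBoundedUnder_rpow_mul_wnorm (hα : 0 < α) (hb : BoundedBlochToWeighted α β u φ) :
    IsBoundedUnder (· ≤ ·) atTop
      fun n : ℕ => ((n : ℝ) + 1) ^ (α - 1) * wnorm β (fun z => u z * φ z ^ n) := by
  obtain ⟨C, hC, h⟩ := hb.2
  refine isBoundedUnder_of_eventually_le (a := profileBound α * C) ?_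
  filter_upwards [eventually_ge_atTop 1] with n hn
  have h1 := (h _ (memBloch_normalizedMonomial hα n)).trans
    (mul_le_of_le_one_right hC.le (blochNorm_normalizedMonomial_le hα hn))
  rwa [wnorm_wcomp_normalizedMonomial hα, inv_mul_le_iff₀ (profileBound_pos hα)] at h1

end LowerBound

/-- **Lemma 4.2 (iii)**. For `α > 1`,
`‖uC_φ‖_{e, B^α → H^∞_ν_β} ≍ limsup_n (n+1)^(α-1) ‖uφ^n‖_ν_β`, with comparison constants
depending only on `α` and `β`. -/
theorem essNorm_Bloch_to_weighted_of_one_lt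
    (α β : ℝ) (hα : 1 < α) (hβ : 0 < β) :
    ∃ c C : ℝ, 0 < c ∧ 0 < C ∧
      ∀ u φ : ℂ → ℂ, DifferentiableOn ℂ u unitDisk → DifferentiableOn ℂ φ unitDisk →
        Set.MapsTo φ unitDisk unitDisk → BoundedBlochToWeighted α β u φ →
        c * Filter.limsup
              (fun n : ℕ => ((n : ℝ) + 1) ^ (α - 1) * wnorm β (fun z => u z * φ z ^ n))
              Filter.atTop
            ≤ essNormW α β u φ ∧
          essNormW α β u φ
            ≤ C * Filter.limsup
                (fun n : ℕ => ((n : ℝ) + 1) ^ (α - 1) * wnorm β (fun z => u z * φ z ^ n))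
                Filter.atTop := by
  have hα0 : 0 < α := by linarith
  have hα' : 0 < α - 1 := by linarith
  have hM := profileBound_pos hα0
  refine ⟨(profileBound α)⁻¹, Real.exp 2 / (α - 1), by positivity, by positivity,
    fun u φ _ hφ hm hb => ⟨?_, ?_⟩⟩
  · rw [inv_mul_le_iff₀ hM]
    exact limsup_le_mul_essNormW hα hφ hm hb
  · have hbdd := isBoundedUnder_rpow_mul_wnorm hα0 hb
    have hnonneg : ∀ n : ℕ,
        0 ≤ ((n : ℝ) + 1) ^ (α - 1) * wnorm β (fun z => u z * φ z ^ n) := fun n =>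
      mul_nonneg (by positivity) (wnorm_nonneg _ _)
    have hL : 0 ≤ limsup (fun n : ℕ =>
        ((n : ℝ) + 1) ^ (α - 1) * wnorm β (fun z => u z * φ z ^ n)) atTop :=
      le_limsup_of_frequently_le (Frequently.of_forall hnonneg) hbdd
    rw [← div_le_iff₀' (by positivity)]
    refine le_of_forall_pos_le_add fun ε hε => ?_
    rw [div_le_iff₀' (by positivity)]
    refine essNormW_le_of_eventually_le hα hb.memWeighted_left hφ hm (by linarith) ?_
    exact (eventually_lt_of_limsup_lt (lt_add_of_pos_right _ hε) hbdd).mono fun n hn => hn.le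

end
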